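/- If (Γ, d) is a right covariant π-graded first order differential calculus over A, then there exists a family of k-linear maps Δ^r = {Δ^r_{α,β}: Γ_{αβ} → Γ_α ⊗ A_β}_{α,β∈π} such that: (1) Δ^r_{α,β}(a·ρ) = Δ_{α,β}(a)·Δ^r_{α,β}(ρ) and Δ^r_{α,β}(ρ·a) = Δ^r_{α,β}(ρ)·Δ_{α,β}(a) for all a ∈ A_{αβ} and ρ ∈ Γ_{αβ}; (2) (id ⊗ Δ_{β,γ}) ∘ Δ^r_{α,βγ} = (Δ^r_{α,β} ⊗ id) ∘ Δ^r_{αβ,γ} for all α,β,γ ∈ π; (3) (id ⊗ ε) ∘ Δ^r_{α,1} = id on Γ_α; (4) Δ^r_{α,β} ∘ d_{αβ} = (d_α ⊗ id) ∘ Δ_{α,β}. (Explicitly, Δ^r_{α,β}(Σ_k a_k·d_{αβ}(b_k)) = Σ_k Δ_{α,β}(a_k)·(d_α ⊗ id)(Δ_{α,β}(b_k)) is well defined.) -/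

import Mathlib

open TensorProduct

/-- The componentwise action of `R ⊗[k] S` on `M ⊗[k] N` induced by `k`-bilinear
actions `f` of `R` on `M` and `g` of `S` on `N`: `(r ⊗ s) • (m ⊗ n) = (f r m) ⊗ (g s n)`. -/
noncomputable def tact {k : Type} [Field k] {R S M N : Type}
    [AddCommGroup R] [Module k R] [AddCommGroup S] [Module k S]
    [AddCommGroup M] [Module k M] [AddCommGroup N] [Module k N]
    (f : R →ₗ[k] M →ₗ[k] M) (g : S →ₗ[k] N →ₗ[k] N) :
    R ⊗[k] S →ₗ[k] (M ⊗[k] N) →ₗ[k] M ⊗[k] N :=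
  TensorProduct.lift (LinearMap.mk₂ k (fun r s => TensorProduct.map (f r) (g s))
    (fun r r' s => by simp only [map_add, TensorProduct.map_add_left])
    (fun c r s => by simp only [map_smul, TensorProduct.map_smul_left])
    (fun r s s' => by simp only [map_add, TensorProduct.map_add_right])
    (fun r c s => by simp only [map_smul, TensorProduct.map_smul_right]))

section Tact

variable {k : Type} [Field k]

@[simp]
theorem tact_tmul {R S M N : Type}
    [AddCommGroup R] [Module k R] [AddCommGroup S] [Module k S]
    [AddCommGroup M] [Module k M] [AddCommGroup N] [Module k N]
    (f : R →ₗ[k] M →ₗ[k] M) (g : S →ₗ[k] N →ₗ[k] N) (r : R) (s : S) (m : M) (n : N) :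
    tact f g (r ⊗ₜ s) (m ⊗ₜ n) = f r m ⊗ₜ g s n := by
  simp [tact]

variable {A B C M : Type} [Ring A] [Algebra k A] [Ring B] [Algebra k B] [Ring C] [Algebra k C]
  [AddCommGroup M] [Module k M]

theorem tact_mul_apply (l : A →ₗ[k] M →ₗ[k] M) (hl : ∀ a b x, l (a * b) x = l a (l b x))
    (x y : A ⊗[k] B) (m : M ⊗[k] B) :
    tact l (LinearMap.mul k B) (x * y) m
      = tact l (LinearMap.mul k B) x (tact l (LinearMap.mul k B) y m) := by
  induction x with
  | zero => simp
  | add x x' hx hx' => simp only [add_mul, map_add, LinearMap.add_apply, hx, hx']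
  | tmul a b =>
    induction y with
    | zero => simp
    | add y y' hy hy' => simp only [mul_add, map_add, LinearMap.add_apply, hy, hy']
    | tmul a' b' =>
      induction m with
      | zero => simp
      | add m m' hm hm' => simp only [map_add, hm, hm']
      | tmul m b'' => simp [hl, mul_assoc]

theorem tact_one_apply (l : A →ₗ[k] M →ₗ[k] M) (hl : ∀ x, l 1 x = x) (m : M ⊗[k] B) :
    tact l (LinearMap.mul k B) 1 m = m := by
  induction m with
  | zero => simp
  | add m m' hm hm' => simp only [map_add, hm, hm']
  | tmul m b => simp [Algebra.TensorProduct.one_def, hl]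

theorem tact_left_right_comm (l r : A →ₗ[k] M →ₗ[k] M)
    (hlr : ∀ a b x, l a (r b x) = r b (l a x)) (x y : A ⊗[k] B) (m : M ⊗[k] B) :
    tact l (LinearMap.mul k B) x (tact r (LinearMap.mul k B).flip y m)
      = tact r (LinearMap.mul k B).flip y (tact l (LinearMap.mul k B) x m) := by
  induction x with
  | zero => simp
  | add x x' hx hx' => simp only [map_add, LinearMap.add_apply, hx, hx']
  | tmul a b =>
    induction y with
    | zero => simp
    | add y y' hy hy' => simp only [map_add, LinearMap.add_apply, hy, hy']
    | tmul a' b' =>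
      induction m with
      | zero => simp
      | add m m' hm hm' => simp only [map_add, hm, hm']
      | tmul m b'' => simp [hlr, mul_assoc]

theorem rTensor_leibniz (l r : A →ₗ[k] M →ₗ[k] M) (d : A →ₗ[k] M)
    (hd : ∀ a b, d (a * b) = r b (d a) + l a (d b)) (x y : A ⊗[k] B) :
    d.rTensor B (x * y) = tact r (LinearMap.mul k B).flip y (d.rTensor B x)
      + tact l (LinearMap.mul k B) x (d.rTensor B y) := by
  induction x with
  | zero => simp
  | add x x' hx hx' =>
    simp only [add_mul, map_add, LinearMap.add_apply, hx, hx']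
    abel
  | tmul a b =>
    induction y with
    | zero => simp
    | add y y' hy hy' =>
      simp only [mul_add, map_add, LinearMap.add_apply, hy, hy']
      abel
    | tmul a' b' => simp [hd, TensorProduct.add_tmul]

theorem lTensor_tact (l : A →ₗ[k] M →ₗ[k] M) (f : B →ₐ[k] C) (x : A ⊗[k] B) (m : M ⊗[k] B) :
    f.toLinearMap.lTensor M (tact l (LinearMap.mul k B) x m)
      = tact l (LinearMap.mul k C) (Algebra.TensorProduct.map (AlgHom.id k A) f x)
          (f.toLinearMap.lTensor M m) := by
  induction x with
  | zero => simp
  | add x x' hx hx' => simp only [map_add, LinearMap.add_apply, hx, hx']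
  | tmul a b =>
    induction m with
    | zero => simp
    | add m m' hm hm' => simp only [map_add, hm, hm']
    | tmul m b' => simp

theorem assoc_tact (l : A →ₗ[k] M →ₗ[k] M) (x : (A ⊗[k] B) ⊗[k] C) (m : (M ⊗[k] B) ⊗[k] C) :
    TensorProduct.assoc k M B C
        (tact (tact l (LinearMap.mul k B)) (LinearMap.mul k C) x m)
      = tact l (LinearMap.mul k (B ⊗[k] C)) (TensorProduct.assoc k A B C x)
          (TensorProduct.assoc k M B C m) := by
  induction x with
  | zero => simp
  | add x x' hx hx' => simp only [map_add, LinearMap.add_apply, hx, hx']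
  | tmul x c =>
    induction x with
    | zero => simp
    | add x x' hx hx' =>
      simp only [TensorProduct.add_tmul, map_add, LinearMap.add_apply, hx, hx']
    | tmul a b =>
      induction m with
      | zero => simp
      | add m m' hm hm' => simp only [map_add, hm, hm']
      | tmul m c' =>
        induction m with
        | zero => simp
        | add m m' hm hm' => simp only [TensorProduct.add_tmul, map_add, hm, hm']
        | tmul m b' => simp

theorem rTensor_tact {A' M' : Type} [Ring A'] [Algebra k A'] [AddCommGroup M'] [Module k M']
    (l : A →ₗ[k] M →ₗ[k] M) (l' : A' →ₗ[k] M' →ₗ[k] M') (f : A →ₐ[k] A') (g : M →ₗ[k] M')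
    (hg : ∀ a m, g (l a m) = l' (f a) (g m)) (x : A ⊗[k] C) (m : M ⊗[k] C) :
    g.rTensor C (tact l (LinearMap.mul k C) x m)
      = tact l' (LinearMap.mul k C) (Algebra.TensorProduct.map f (AlgHom.id k C) x)
          (g.rTensor C m) := by
  induction x with
  | zero => simp
  | add x x' hx hx' => simp only [map_add, LinearMap.add_apply, hx, hx']
  | tmul a b =>
    induction m with
    | zero => simp
    | add m m' hm hm' => simp only [map_add, hm, hm']
    | tmul m b' => simp [hg]

theorem rid_lTensor_tact (l : A →ₗ[k] M →ₗ[k] M) (f : B →ₐ[k] k) (x : A ⊗[k] B)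
    (m : M ⊗[k] B) :
    TensorProduct.rid k M (f.toLinearMap.lTensor M (tact l (LinearMap.mul k B) x m))
      = l (TensorProduct.rid k A (f.toLinearMap.lTensor A x))
          (TensorProduct.rid k M (f.toLinearMap.lTensor M m)) := by
  induction x with
  | zero => simp
  | add x x' hx hx' => simp only [map_add, LinearMap.add_apply, hx, hx']
  | tmul a b =>
    induction m with
    | zero => simp
    | add m m' hm hm' => simp only [map_add, hm, hm']
    | tmul m b' => simp [smul_smul, mul_comm]

theorem rid_lTensor_rTensor (d : A →ₗ[k] M) (f : B →ₗ[k] k) (x : A ⊗[k] B) :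
    TensorProduct.rid k M (f.lTensor M (d.rTensor B x))
      = d (TensorProduct.rid k A (f.lTensor A x)) := by
  induction x with
  | zero => simp
  | add x x' hx hx' => simp only [map_add, hx, hx']
  | tmul a b => simp

theorem lTensor_rTensor_eq_rTensor_map (d : A →ₗ[k] M) (f : B →ₐ[k] C) (x : A ⊗[k] B) :
    f.toLinearMap.lTensor M (d.rTensor B x)
      = d.rTensor C (Algebra.TensorProduct.map (AlgHom.id k A) f x) := by
  induction x with
  | zero => simp
  | add x x' hx hx' => simp only [map_add, hx, hx']
  | tmul a b => simp

theorem rTensor_assoc (d : A →ₗ[k] M) (x : (A ⊗[k] B) ⊗[k] C) :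
    d.rTensor (B ⊗[k] C) (TensorProduct.assoc k A B C x)
      = TensorProduct.assoc k M B C ((d.rTensor B).rTensor C x) := by
  induction x with
  | zero => simp
  | add x x' hx hx' => simp only [map_add, hx, hx']
  | tmul x c =>
    induction x with
    | zero => simp
    | add x x' hx hx' => simp only [TensorProduct.add_tmul, map_add, hx, hx']
    | tmul a b => simp

theorem rTensor_rTensor_eq_rTensor_map {A' M' : Type} [Ring A'] [Algebra k A'] [AddCommGroup M']
    [Module k M'] (d : A →ₗ[k] M) (d' : A' →ₗ[k] M') (f : A →ₐ[k] A') (g : M →ₗ[k] M')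
    (hg : ∀ a, g (d a) = d' (f a)) (x : A ⊗[k] C) :
    g.rTensor C (d.rTensor C x)
      = d'.rTensor C (Algebra.TensorProduct.map f (AlgHom.id k C) x) := by
  induction x with
  | zero => simp
  | add x x' hx hx' => simp only [map_add, hx, hx']
  | tmul a b => simp [hg]

end Tact

/-- A linear map defined on `k`-linear combinations of the elements `l a (d b)` by prescribing its
values bilinearly in `(a, b)`, provided that the prescription respects linear relations. -/
theorem exists_linearMap_of_generators {k A M N : Type} [Field k] [AddCommGroup A] [Module k A]
    [AddCommGroup M] [Module k M] [AddCommGroup N] [Module k N]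
    (p : A →ₗ[k] A →ₗ[k] M) (q : A →ₗ[k] A →ₗ[k] N)
    (hspan : ∀ x : M, x ∈ Submodule.span k {y : M | ∃ a b : A, y = p a b})
    (hrel : ∀ (n : ℕ) (a b : Fin n → A), ∑ i, p (a i) (b i) = 0 → ∑ i, q (a i) (b i) = 0) :
    ∃ D : M →ₗ[k] N, ∀ a b, D (p a b) = q a b := by
  have hsurj : LinearMap.range (TensorProduct.lift p) = ⊤ := by
    refine eq_top_iff.2 fun x _ => Submodule.span_le.2 ?_ (hspan x)
    rintro _ ⟨a, b, rfl⟩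
    exact ⟨a ⊗ₜ b, TensorProduct.lift.tmul a b⟩
  have hker : ∀ t, TensorProduct.lift p t = 0 → TensorProduct.lift q t = 0 := by
    intro t ht
    obtain ⟨n, a, b, rfl⟩ := TensorProduct.exists_sum_tmul_eq t
    simp only [map_sum, TensorProduct.lift.tmul] at ht ⊢
    exact hrel n a b ht
  obtain ⟨s, hs⟩ := (TensorProduct.lift p).exists_rightInverse_of_surjective hsurj
  refine ⟨TensorProduct.lift q ∘ₗ s, fun a b => ?_⟩
  have h := hker (s (p a b) - a ⊗ₜ b) (by
    rw [map_sub, TensorProduct.lift.tmul, sub_eq_zero]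
    exact LinearMap.congr_fun hs (p a b))
  rwa [map_sub, TensorProduct.lift.tmul, sub_eq_zero] at h

/-- A right covariant `π`-graded first order differential calculus `(Γ, d)`
over a Hopf `π`-coalgebra `A` admits a family of linear maps
`Δʳ_{α,β} : Γ_{αβ} → Γ_α ⊗ A_β` compatible with the bimodule structures, coassociative,
counital, and satisfying `Δʳ_{α,β} ∘ d_{αβ} = (d_α ⊗ id) ∘ Δ_{α,β}`. -/
theorem right_covariant_fodc_exists_right_coaction
    {k : Type} [Field k] {G : Type} [Group G]
    (A : G → Type) [∀ α, Ring (A α)] [∀ α, Algebra k (A α)]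
    (Δ : ∀ α β γ : G, α * β = γ → (A γ →ₐ[k] A α ⊗[k] A β))
    (ε : A 1 →ₐ[k] k)
    (S : ∀ α β : G, α⁻¹ = β → (A α →ₗ[k] A β))
    (hcoassoc : ∀ (α β γ : G) (x : A (α * β * γ)),
      (TensorProduct.assoc k (A α) (A β) (A γ))
          ((Algebra.TensorProduct.map (Δ α β (α * β) rfl) (AlgHom.id k (A γ)))
            ((Δ (α * β) γ (α * β * γ) rfl) x))
        = (Algebra.TensorProduct.map (AlgHom.id k (A α)) (Δ β γ (β * γ) rfl))
            ((Δ α (β * γ) (α * β * γ) (mul_assoc α β γ).symm) x))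
    (hcounit₁ : ∀ (α : G) (x : A α),
      (TensorProduct.rid k (A α)) ((LinearMap.lTensor (A α) ε.toLinearMap)
        ((Δ α 1 α (mul_one α)) x)) = x)
    (hcounit₂ : ∀ (α : G) (x : A α),
      (TensorProduct.lid k (A α)) ((LinearMap.rTensor (A α) ε.toLinearMap)
        ((Δ 1 α α (one_mul α)) x)) = x)
    (hantipode₁ : ∀ (α : G) (x : A 1),
      (LinearMap.mul' k (A α)) ((LinearMap.rTensor (A α) (S α⁻¹ α (inv_inv α)))
        ((Δ α⁻¹ α 1 (inv_mul_cancel α)) x)) = ε x • 1)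
    (hantipode₂ : ∀ (α : G) (x : A 1),
      (LinearMap.mul' k (A α)) ((LinearMap.lTensor (A α) (S α⁻¹ α (inv_inv α)))
        ((Δ α α⁻¹ 1 (mul_inv_cancel α)) x)) = ε x • 1)
    (Γ : G → Type) [∀ α, AddCommGroup (Γ α)] [∀ α, Module k (Γ α)]
    (sl sr : ∀ α, A α →ₗ[k] Γ α →ₗ[k] Γ α)
    (hsl_one : ∀ (α : G) (x : Γ α), sl α 1 x = x)
    (hsl_mul : ∀ (α : G) (a b : A α) (x : Γ α), sl α (a * b) x = sl α a (sl α b x))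
    (hsr_one : ∀ (α : G) (x : Γ α), sr α 1 x = x)
    (hsr_mul : ∀ (α : G) (a b : A α) (x : Γ α), sr α (a * b) x = sr α b (sr α a x))
    (hslr : ∀ (α : G) (a b : A α) (x : Γ α), sl α a (sr α b x) = sr α b (sl α a x))
    (d : ∀ α, A α →ₗ[k] Γ α)
    (hLeibniz : ∀ (α : G) (a b : A α), d α (a * b) = sr α b (d α a) + sl α a (d α b))
    (hgen : ∀ (α : G) (x : Γ α),
      x ∈ Submodule.span k {y : Γ α | ∃ a b : A α, y = sl α a (d α b)})
    (hrcov : ∀ (α β : G) (n : ℕ) (a b : Fin n → A (α * β)),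
      (∑ i, sl (α * β) (a i) (d (α * β) (b i))) = 0 →
      (∑ i, tact (sl α) (LinearMap.mul k (A β)) ((Δ α β (α * β) rfl) (a i))
          ((LinearMap.rTensor (A β) (d α)) ((Δ α β (α * β) rfl) (b i)))) = 0) :
    ∃ Dr : ∀ α β γ : G, α * β = γ → (Γ γ →ₗ[k] Γ α ⊗[k] A β),
      (∀ (α β γ : G) (h : α * β = γ) (a : A γ) (ρ : Γ γ),
        Dr α β γ h (sl γ a ρ)
          = tact (sl α) (LinearMap.mul k (A β)) ((Δ α β γ h) a) (Dr α β γ h ρ))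
      ∧ (∀ (α β γ : G) (h : α * β = γ) (a : A γ) (ρ : Γ γ),
        Dr α β γ h (sr γ a ρ)
          = tact (sr α) ((LinearMap.mul k (A β)).flip) ((Δ α β γ h) a) (Dr α β γ h ρ))
      ∧ (∀ (α β γ : G) (ρ : Γ (α * β * γ)),
        (LinearMap.lTensor (Γ α) (Δ β γ (β * γ) rfl).toLinearMap)
            (Dr α (β * γ) (α * β * γ) (mul_assoc α β γ).symm ρ)
          = (TensorProduct.assoc k (Γ α) (A β) (A γ))
              ((LinearMap.rTensor (A γ) (Dr α β (α * β) rfl))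
                (Dr (α * β) γ (α * β * γ) rfl ρ)))
      ∧ (∀ (α : G) (ρ : Γ α),
        (TensorProduct.rid k (Γ α))
          ((LinearMap.lTensor (Γ α) ε.toLinearMap) (Dr α 1 α (mul_one α) ρ)) = ρ)
      ∧ (∀ (α β γ : G) (h : α * β = γ) (a : A γ),
        Dr α β γ h (d γ a) = (LinearMap.rTensor (A β) (d α)) ((Δ α β γ h) a)) := by
  have hex : ∀ (α β γ : G) (h : α * β = γ), ∃ D : Γ γ →ₗ[k] Γ α ⊗[k] A β,
      ∀ a b, D (sl γ a (d γ b)) = tact (sl α) (LinearMap.mul k (A β)) (Δ α β γ h a)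
        ((d α).rTensor (A β) (Δ α β γ h b)) := by
    rintro α β _ rfl
    exact exists_linearMap_of_generators ((sl (α * β)).compl₂ (d (α * β)))
      ((tact (sl α) (LinearMap.mul k (A β))).compl₁₂ (Δ α β _ rfl).toLinearMap
        ((d α).rTensor (A β) ∘ₗ (Δ α β _ rfl).toLinearMap))
      (hgen _) (hrcov α β)
  choose Dr hDr using hex
  have ext_gen : ∀ {γ : G} {N : Type} [AddCommGroup N] [Module k N] (f g : Γ γ →ₗ[k] N),
      (∀ a b, f (sl γ a (d γ b)) = g (sl γ a (d γ b))) → ∀ ρ, f ρ = g ρ := by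
    intro γ N _ _ f g hfg ρ
    refine LinearMap.eqOn_span (s := {y | ∃ a b, y = sl γ a (d γ b)}) ?_ (hgen γ ρ)
    rintro _ ⟨a, b, rfl⟩
    exact hfg a b
  have hDrd : ∀ (α β γ : G) (h : α * β = γ) (a : A γ),
      Dr α β γ h (d γ a) = (d α).rTensor (A β) (Δ α β γ h a) := by
    intro α β γ h a
    rw [← hsl_one γ (d γ a), hDr, map_one, tact_one_apply _ (hsl_one α)]
  have hDrl : ∀ (α β γ : G) (h : α * β = γ) (a : A γ) (ρ : Γ γ), Dr α β γ h (sl γ a ρ)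
      = tact (sl α) (LinearMap.mul k (A β)) (Δ α β γ h a) (Dr α β γ h ρ) := by
    intro α β γ h a
    refine ext_gen (Dr α β γ h ∘ₗ sl γ a)
      (tact (sl α) (LinearMap.mul k (A β)) (Δ α β γ h a) ∘ₗ Dr α β γ h) fun b c => ?_
    simp only [LinearMap.comp_apply]
    rw [← hsl_mul, hDr, hDr, map_mul, tact_mul_apply _ (hsl_mul α)]
  refine ⟨Dr, hDrl, fun α β γ h a => ?_, fun α β γ => ?_, fun α => ?_, hDrd⟩
  · refine ext_gen (Dr α β γ h ∘ₗ sr γ a)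
      (tact (sr α) (LinearMap.mul k (A β)).flip (Δ α β γ h a) ∘ₗ Dr α β γ h) fun b c => ?_
    simp only [LinearMap.comp_apply]
    have hr : sr γ a (d γ c) = d γ (c * a) - sl γ c (d γ a) := by
      rw [hLeibniz, add_sub_cancel_right]
    rw [← hslr, hDrl, hr, map_sub, hDrd, hDr, map_mul,
      rTensor_leibniz _ _ _ (hLeibniz α), add_sub_cancel_right,
      tact_left_right_comm _ _ (hslr α), hDr]
  · refine ext_gen ((Δ β γ (β * γ) rfl).toLinearMap.lTensor (Γ α) ∘ₗ
        Dr α (β * γ) (α * β * γ) (mul_assoc α β γ).symm)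
      ((TensorProduct.assoc k (Γ α) (A β) (A γ)).toLinearMap ∘ₗ
        (Dr α β (α * β) rfl).rTensor (A γ) ∘ₗ Dr (α * β) γ (α * β * γ) rfl) fun a b => ?_
    simp only [LinearMap.comp_apply, LinearEquiv.coe_coe]
    rw [hDr, hDr, lTensor_tact, lTensor_rTensor_eq_rTensor_map, ← hcoassoc, ← hcoassoc,
      rTensor_tact _ _ _ _ (hDrl α β (α * β) rfl),
      rTensor_rTensor_eq_rTensor_map _ _ _ _ (hDrd α β (α * β) rfl), assoc_tact, rTensor_assoc]
  · refine ext_gen ((TensorProduct.rid k (Γ α)).toLinearMap ∘ₗ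
      ε.toLinearMap.lTensor (Γ α) ∘ₗ Dr α 1 α (mul_one α)) LinearMap.id fun a b => ?_
    simp only [LinearMap.comp_apply, LinearEquiv.coe_coe, LinearMap.id_apply]
    rw [hDr, rid_lTensor_tact, rid_lTensor_rTensor, hcounit₁, hcounit₁]
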